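/- For every natural number n ≥ 2 and every real number x > 0, one has ((n−1)!·f_n(x))² − (n−1)!·f_n(x)·(x^n + n·x^{n−1}) + x^{2n−1} > 0. -/

import Mathlib

/-- The signed tail of the Taylor series of `e^{-x}`:
`f k x = (-1)^k ∑_{j=k}^∞ (-x)^j / j!`. -/
noncomputable def f (k : ℕ) (x : ℝ) : ℝ :=
  (-1 : ℝ) ^ k * ∑' j : ℕ, (-x) ^ (k + j) / (Nat.factorial (k + j))

lemma aux_pos (K : ℝ → ℝ) (hc : ContinuousOn K (Set.Ici 0)) (h0 : 0 ≤ K 0)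
    (hd : ∀ x, 0 < x → K x ≤ 0 → ∃ d, 0 < d ∧ HasDerivAt K d x) (x : ℝ) (hx : 0 < x) :
    0 < K x := by
  by_contra hneg
  push Not at hneg
  have key : ∀ z, 0 < z → z ≤ x → K z ≤ 0 → (∀ y ∈ Set.Icc 0 x, K z ≤ K y) → False := by
    intro z hz hzx hKz hmin
    obtain ⟨d, hdpos, hder⟩ := hd z hz hKz
    have h1 := (hasDerivAt_iff_tendsto_slope.1 hder).eventually (lt_mem_nhds hdpos)
    have h2 : ∀ᶠ y in nhdsWithin z (Set.Iio z), 0 < slope K z y :=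
      h1.filter_mono (nhdsWithin_mono z (fun y hy => ne_of_lt hy))
    have h3 : ∀ᶠ y in nhdsWithin z (Set.Iio z), 0 < y :=
      (lt_mem_nhds hz).filter_mono nhdsWithin_le_nhds
    obtain ⟨y, ⟨hy1, hy2⟩, hy3⟩ := ((h2.and h3).and self_mem_nhdsWithin).exists
    have hy3' : y < z := hy3
    have := hmin y ⟨hy2.le, by linarith⟩
    rw [slope_def_field] at hy1
    have h4 : (K y - K z) / (y - z) ≤ 0 :=
      div_nonpos_of_nonneg_of_nonpos (by linarith) (by linarith)
    linarith
  obtain ⟨z, hz, hmin⟩ := isCompact_Icc.exists_isMinOn (s := Set.Icc 0 x) ⟨0, ⟨le_rfl, hx.le⟩⟩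
    (hc.mono (fun y hy => hy.1))
  have hmin' : ∀ y ∈ Set.Icc 0 x, K z ≤ K y := fun y hy => hmin hy
  have hxm := hmin' x ⟨hx.le, le_rfl⟩
  rcases hz.1.eq_or_lt with h | h
  · subst h
    exact key x hx le_rfl hneg (fun y hy => by linarith [hmin' y hy])
  · exact key z h hz.2 (by linarith) hmin'

noncomputable def auxG (k : ℕ) (x : ℝ) : ℝ := ∑' j : ℕ, (-x) ^ j / (Nat.factorial (k + j))

lemma auxG_bound (k j : ℕ) (x b : ℝ) (h : |x| ≤ b) :
    ‖(-x) ^ j / (Nat.factorial (k + j) : ℝ)‖ ≤ b ^ j / (Nat.factorial j) := by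
  rw [norm_div, norm_pow, norm_neg, Real.norm_eq_abs, Real.norm_natCast]
  have : (Nat.factorial j : ℝ) ≤ Nat.factorial (k + j) := by
    exact_mod_cast Nat.factorial_le (by omega)
  have h0 : (0 : ℝ) < Nat.factorial j := by exact_mod_cast Nat.factorial_pos j
  have hb : 0 ≤ b := (abs_nonneg x).trans h
  gcongr

lemma auxG_summable (k : ℕ) (x : ℝ) :
    Summable (fun j : ℕ => (-x) ^ j / (Nat.factorial (k + j) : ℝ)) :=
  Summable.of_norm_bounded (Real.summable_pow_div_factorial |x|)
    (fun j => auxG_bound k j x _ le_rfl)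

lemma auxG_cont (k : ℕ) : Continuous (auxG k) := by
  rw [continuous_iff_continuousAt]
  intro x
  have : ContinuousOn (auxG k) (Set.Icc (-(|x|+1)) (|x|+1)) := by
    apply continuousOn_tsum (u := fun j => (|x|+1) ^ j / (Nat.factorial j : ℝ))
    · intro j; fun_prop
    · exact Real.summable_pow_div_factorial _
    · intro j y hy
      exact auxG_bound k j y _ (abs_le.2 hy)
  apply this.continuousAt
  apply Icc_mem_nhds <;> [linarith [neg_abs_le x]; linarith [le_abs_self x]]

lemma auxG_zero (k : ℕ) : auxG k 0 = 1 / Nat.factorial k := by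
  unfold auxG
  rw [tsum_eq_single 0]
  · simp
  · intro j hj; simp [hj]

lemma auxG_succ (k : ℕ) (x : ℝ) : auxG k x = 1 / Nat.factorial k - x * auxG (k+1) x := by
  unfold auxG
  rw [(auxG_summable k x).tsum_eq_zero_add]
  have h : ∑' j : ℕ, (-x) ^ (j + 1) / (Nat.factorial (k + (j + 1)) : ℝ)
      = (-x) * ∑' j : ℕ, (-x) ^ j / (Nat.factorial (k + 1 + j) : ℝ) := by
    rw [← tsum_mul_left]
    refine tsum_congr fun j => ?_
    rw [show k + 1 + j = k + (j + 1) by ring]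
    ring
  rw [h]
  simp
  ring

lemma f_eq (k : ℕ) (x : ℝ) : f k x = x ^ k * auxG k x := by
  unfold f auxG
  rw [← tsum_mul_left, ← tsum_mul_left]
  congr 1; ext j
  rw [pow_add, neg_pow x k]
  have : ((-1:ℝ)^k) * (-1)^k = 1 := by rw [← mul_pow]; norm_num
  linear_combination (x ^ k * (-x)^j / (Nat.factorial (k + j) : ℝ)) * this

lemma f_succ (k : ℕ) (x : ℝ) : f (k+1) x = x ^ k / Nat.factorial k - f k x := by
  rw [f_eq, f_eq, auxG_succ k x]; ring

lemma f_zero (x : ℝ) : f 0 x = Real.exp (-x) := by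
  rw [Real.exp_eq_exp_ℝ, NormedSpace.exp_eq_tsum_div]
  simp [f]

lemma f_deriv (k : ℕ) (x : ℝ) : HasDerivAt (f (k+1)) (f k x) x := by
  induction k with
  | zero =>
    have h : f (0+1) = fun x => 1 - Real.exp (-x) := by
      ext y; rw [f_succ, f_zero]; simp
    rw [h, f_zero]
    have := ((hasDerivAt_neg x).exp).const_sub 1
    simpa using this
  | succ k ih =>
    have h : f (k+1+1) = fun x => x ^ (k+1) / Nat.factorial (k+1) - f (k+1) x := by
      ext y; rw [f_succ]
    rw [h, f_succ k x]
    refine (((hasDerivAt_pow (k+1) x).div_const (Nat.factorial (k+1) : ℝ)).sub ih).congr_deriv ?_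
    rw [Nat.factorial_succ]
    have : (Nat.factorial k : ℝ) ≠ 0 := by exact_mod_cast Nat.factorial_ne_zero k
    push_cast
    field_simp

noncomputable def auxg (m : ℕ) (x : ℝ) : ℝ := Nat.factorial m * auxG (m+1) x

lemma auxg_deriv (m : ℕ) (x : ℝ) (hx : 0 < x) :
    HasDerivAt (auxg m) ((1 - (x + (m+1)) * auxg m x) / x) x := by
  have h1 := ((f_deriv m x).const_mul (Nat.factorial m : ℝ)).div (hasDerivAt_pow (m+1) x)
    (pow_ne_zero _ hx.ne')
  have h2 := h1.congr_of_eventuallyEq (f₁ := auxg m) (by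
    filter_upwards [lt_mem_nhds hx] with y hy
    simp only [auxg, f_eq, Pi.div_apply]
    field_simp)
  refine h2.congr_deriv ?_
  have : (Nat.factorial m : ℝ) ≠ 0 := by exact_mod_cast Nat.factorial_ne_zero m
  simp only [auxg, f_eq, auxG_succ m x, Nat.add_sub_cancel]
  push_cast
  field_simp
  ring

lemma auxg_lt (m : ℕ) (hm : 1 ≤ m) (x : ℝ) (hx : 0 < x) : 0 < 1 - x * auxg m x := by
  have hc : Continuous (auxg m) := continuous_const.mul (auxG_cont _)
  refine aux_pos (fun x => 1 - x * auxg m x) (by fun_prop) (by simp) ?_ x hx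
  intro y hy h
  have hd := ((hasDerivAt_id y).mul (auxg_deriv m y hy)).const_sub 1
  refine ⟨_, ?_, hd⟩
  simp only [id]
  rw [mul_div_cancel₀ _ hy.ne']
  have hg : 0 < auxg m y := by
    by_contra hh
    push Not at hh
    nlinarith
  have hn : (1:ℝ) ≤ m := by exact_mod_cast hm
  nlinarith

lemma auxH_pos (m : ℕ) (hm : 1 ≤ m) (x : ℝ) (hx : 0 < x) :
    0 < x * auxg m x ^ 2 - auxg m x * (x + (m + 1)) + 1 := by
  have hc : Continuous (auxg m) := continuous_const.mul (auxG_cont _)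
  refine aux_pos (fun x => x * auxg m x ^ 2 - auxg m x * (x + (m + 1)) + 1) (by fun_prop) ?_ ?_ x hx
  · have : (Nat.factorial m : ℝ) ≠ 0 := by exact_mod_cast Nat.factorial_ne_zero m
    have h2 : (m + 1 : ℝ) ≠ 0 := by positivity
    simp only [auxg, auxG_zero, Nat.factorial_succ]
    push_cast
    apply le_of_eq
    field_simp
    ring
  · intro y hy h
    have hg := auxg_deriv m y hy
    have hd := (((hasDerivAt_id y).mul (hg.pow 2)).sub
      (hg.mul ((hasDerivAt_id y).add_const ((m:ℝ)+1)))).add_const 1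
    have hl := auxg_lt m hm y hy
    set g := auxg m y with hgdef
    refine ⟨(y * g - y - (m+1)) / y * (y * g ^ 2 - g * (y + (m + 1)) + 1) + (1 - y * g) * g^2, ?_, ?_⟩
    · have hne : g ≠ 0 := by
        intro h0
        rw [h0] at h
        norm_num at h
      have hn : (0:ℝ) ≤ m := Nat.cast_nonneg m
      have a : 0 < (1 - y * g) * g^2 := by positivity
      have b : (y * g - y - (m+1)) / y ≤ 0 := div_nonpos_of_nonpos_of_nonneg (by linarith) hy.le
      have := mul_nonneg_of_nonpos_of_nonpos b h
      linarith
    · refine hd.congr_deriv ?_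
      simp only [id, Pi.pow_apply, ← hgdef]
      field_simp
      push_cast
      ring

theorem stmt_13 (n : ℕ) (hn : 2 ≤ n) (x : ℝ) (hx : 0 < x) :
    0 < ((Nat.factorial (n - 1)) * f n x) ^ 2 -
        (Nat.factorial (n - 1)) * f n x * (x ^ n + (n : ℝ) * x ^ (n - 1)) +
        x ^ (2 * n - 1) := by
  obtain ⟨m, rfl⟩ : ∃ m, n = m + 1 := ⟨n - 1, by omega⟩
  have h := mul_pos (pow_pos hx (2 * m + 1)) (auxH_pos m (by omega) x hx)
  rw [show 2 * (m + 1) - 1 = 2 * m + 1 by omega, Nat.add_sub_cancel, f_eq]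
  refine lt_of_lt_of_eq h ?_
  unfold auxg
  push_cast
  ring
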